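/- In the field ℚ(L,M), the identity e·w − e·w² + 1 + w² = (1+LM)·x̃(L,M)/(M·(L+M)³) holds; that is, the image of EQ − EQ² + 1 + Q² under the rational map φ (given by φ(E) = e, φ(Q) = w) equals (1+LM)·x(L,M^{1/2})/(M(L+M)³), where x is the Hoste–Shanahan recursion coefficient for the A-polynomials of twist knots. -/

import Mathlib

noncomputable section

/-- The field `ℚ(L,M)` of rational functions in two variables. -/
abbrev K : Type := FractionRing (MvPolynomial (Fin 2) ℚ)

/-- The variable `L`. -/
def Lv : K := algebraMap (MvPolynomial (Fin 2) ℚ) K (MvPolynomial.X 0)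

/-- The variable `M`. -/
def Mv : K := algebraMap (MvPolynomial (Fin 2) ℚ) K (MvPolynomial.X 1)

/-- `e = φ(E) = L(M²-1)²/(M(L+M)(1+LM))`. -/
def e : K := Lv * (Mv ^ 2 - 1) ^ 2 / (Mv * (Lv + Mv) * (1 + Lv * Mv))

/-- `w = φ(Q) = (1+LM)/(L+M)`. -/
def w : K := (1 + Lv * Mv) / (Lv + Mv)

/-- The Hoste–Shanahan recursion coefficient `x(L,M^{1/2})`. -/
def xt : K :=
  -Lv + Lv ^ 2 + 2 * Lv * Mv + Mv ^ 2 + 2 * Lv * Mv ^ 2 + Lv ^ 2 * Mv ^ 2 +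
    2 * Lv * Mv ^ 3 + Mv ^ 4 - Lv * Mv ^ 4

open MvPolynomial in
theorem algebraMap_ne_zero_of_eval_ne_zero {p : MvPolynomial (Fin 2) ℚ} (a : Fin 2 → ℚ)
    (h : eval a p ≠ 0) : algebraMap (MvPolynomial (Fin 2) ℚ) K p ≠ 0 := by
  rw [Ne, FaithfulSMul.algebraMap_eq_zero_iff]
  rintro rfl
  exact h (map_zero _)

theorem Mv_ne_zero : Mv ≠ 0 :=
  algebraMap_ne_zero_of_eval_ne_zero 1 (by simp)

open MvPolynomial in
theorem Lv_add_Mv_ne_zero : Lv + Mv ≠ 0 := by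
  have h := algebraMap_ne_zero_of_eval_ne_zero (p := X 0 + X 1) 1 (by norm_num)
  rwa [map_add] at h

open MvPolynomial in
theorem one_add_Lv_mul_Mv_ne_zero : 1 + Lv * Mv ≠ 0 := by
  have h := algebraMap_ne_zero_of_eval_ne_zero (p := 1 + X 0 * X 1) 1 (by norm_num)
  rwa [map_add, map_mul, map_one] at h

/-- The image of `EQ - EQ² + 1 + Q²` under the rational map `φ` equals
`(1+LM)·x(L,M^{1/2})/(M(L+M)³)` in `ℚ(L,M)`. -/
theorem phi_of_three_term_coefficient :
    e * w - e * w ^ 2 + 1 + w ^ 2 = (1 + Lv * Mv) * xt / (Mv * (Lv + Mv) ^ 3) := by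
  have hM := Mv_ne_zero
  have hLM := Lv_add_Mv_ne_zero
  have hLM' := one_add_Lv_mul_Mv_ne_zero
  unfold e w xt
  generalize Lv = l at *
  generalize Mv = m at *
  field_simp
  ring

end
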